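/- arXiv:2206.08114 — 9 statements merged into one kernel-verified Lean document; each statement's English description precedes it below -/
import Mathlib

section
/- Let N be a natural number, λ > 0, μ ∈ ℝ, and p ∈ ℂ. Define V_{μ,p} : ℂ → ℝ by V_{μ,p}(z) = log( e^μ / (1 + (e^μ/λ)|z^{N+1} − p|²)² ). Then V_{μ,p} is smooth and satisfies ΔV_{μ,p}(z) + (8(N+1)²/λ)·|z|^{2N}·e^{V_{μ,p}(z)} = 0 for every z ∈ ℂ. -/
open Real

/-- The Euclidean Laplacian on ℝ² ≅ ℂ: sum of the two pure second partial derivatives. -/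
noncomputable def lapC (f : ℂ → ℝ) (z : ℂ) : ℝ :=
  fderiv ℝ (fun w => fderiv ℝ f w 1) z 1 +
    fderiv ℝ (fun w => fderiv ℝ f w Complex.I) z Complex.I

/-- The first derivative of `z ↦ a - 2 log (1 + c |g z|²)` for holomorphic `g`. -/
theorem hasFDerivAt_liouville (a c : ℝ) (hc : 0 ≤ c) (g : ℂ → ℂ) (g₁ w : ℂ)
    (hg : HasDerivAt g g₁ w) :
    HasFDerivAt (fun z => a - 2 * Real.log (1 + c * ‖g z‖ ^ 2))
      ((-4 * c / (1 + c * ‖g w‖ ^ 2)) •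
        (innerSL ℝ (g w)).comp (ContinuousLinearMap.toSpanSingleton ℂ g₁ |>.restrictScalars ℝ))
      w := by
  have hD : (1 + c * ‖g w‖ ^ 2) ≠ 0 := by positivity
  have hg' := hg.hasFDerivAt.restrictScalars ℝ
  have h := ((((hg'.norm_sq).const_mul c).const_add 1).log hD |>.const_mul 2).const_sub a
  refine h.congr_fderiv ?_
  ext v
  simp
  field_simp
  ring

/-- For holomorphic `g`, `z ↦ a - 2 log (1 + c |g z|²)` has Laplacian
`-8 c |g'|² / (1 + c |g|²)²`. -/
theorem lapC_liouville (a c : ℝ) (hc : 0 ≤ c) (g g₁ : ℂ → ℂ) (g₂ z : ℂ)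
    (hg : ∀ w, HasDerivAt g (g₁ w) w) (hg₁ : HasDerivAt g₁ g₂ z) :
    lapC (fun z => a - 2 * Real.log (1 + c * ‖g z‖ ^ 2)) z =
      -8 * c * ‖g₁ z‖ ^ 2 / (1 + c * ‖g z‖ ^ 2) ^ 2 := by
  have hD : (1 + c * ‖g z‖ ^ 2) ≠ 0 := by positivity
  have first (v : ℂ) : (fun w => fderiv ℝ (fun z => a - 2 * Real.log (1 + c * ‖g z‖ ^ 2)) w v) =
      fun w => (-4 * c) * (inner ℝ (g w) (g₁ w * v) * (1 + c * ‖g w‖ ^ 2)⁻¹) := by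
    funext w
    rw [(hasFDerivAt_liouville a c hc g (g₁ w) w (hg w)).fderiv]
    simp [mul_comm v]
    ring
  have second (v : ℂ) :
      fderiv ℝ (fun w => (-4 * c) * (inner ℝ (g w) (g₁ w * v) * (1 + c * ‖g w‖ ^ 2)⁻¹)) z v =
        (-4 * c) * ((inner ℝ (g z) (g₂ * v * v) + inner ℝ (g₁ z * v) (g₁ z * v)) *
            (1 + c * ‖g z‖ ^ 2)⁻¹ -
          2 * c * inner ℝ (g z) (g₁ z * v) ^ 2 / (1 + c * ‖g z‖ ^ 2) ^ 2) := by
    have h0 := (hg z).hasFDerivAt.restrictScalars ℝ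
    have h1 := (hg₁.mul_const v).hasFDerivAt.restrictScalars ℝ
    have h2 := (hasDerivAt_inv hD).comp_hasFDerivAt z ((h0.norm_sq.const_mul c).const_add 1)
    have h3 := ((h0.inner ℝ h1).mul h2).const_mul (-4 * c)
    refine (congrArg (fun L : ℂ →L[ℝ] ℝ => L v) h3.fderiv).trans ?_
    simp [mul_comm v]
    field_simp
    ring
  rw [lapC, first 1, first Complex.I, second 1, second Complex.I]
  field_simp
  simp only [Complex.inner, Complex.sq_norm, Complex.normSq_apply, Complex.mul_re, Complex.mul_im,
    Complex.conj_re, Complex.conj_im, Complex.I_re, Complex.I_im, Complex.I_sq, Complex.neg_re, Complex.neg_im,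
    Complex.one_re, Complex.one_im]
  ring

/-- `V_{μ,p}(z) = log (e^μ / (1 + (e^μ/λ)|z^{N+1} − p|²)²)` is smooth and solves
`ΔV + (8(N+1)²/λ) |z|^{2N} e^V = 0` on ℂ. -/
theorem global_singular_liouville_solution (N : ℕ) (lam μ : ℝ) (hlam : 0 < lam) (p : ℂ)
    (V : ℂ → ℝ)
    (hV : ∀ z : ℂ,
      V z = Real.log (Real.exp μ / (1 + Real.exp μ / lam * ‖z ^ (N + 1) - p‖ ^ 2) ^ 2)) :
    ContDiff ℝ (⊤ : ℕ∞) V ∧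
    ∀ z : ℂ, lapC V z + 8 * ((N : ℝ) + 1) ^ 2 / lam * ‖z‖ ^ (2 * N) * Real.exp (V z) = 0 := by
  have hc : 0 ≤ Real.exp μ / lam := by positivity
  have hD (z : ℂ) : (1 + Real.exp μ / lam * ‖z ^ (N + 1) - p‖ ^ 2) ≠ 0 := by positivity
  have hV' : V = fun z => μ - 2 * Real.log (1 + Real.exp μ / lam * ‖z ^ (N + 1) - p‖ ^ 2) := by
    funext z
    rw [hV, Real.log_div (Real.exp_ne_zero μ) (pow_ne_zero 2 (hD z)), Real.log_exp, Real.log_pow]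
    norm_num
  constructor
  · rw [hV']
    refine contDiff_const.sub (contDiff_const.mul (ContDiff.log ?_ hD))
    exact contDiff_const.add (contDiff_const.mul (((contDiff_id.pow _).sub contDiff_const).norm_sq ℝ))
  · intro z
    have hg (w : ℂ) : HasDerivAt (fun w : ℂ => w ^ (N + 1) - p) (((N : ℂ) + 1) * w ^ N) w := by
      simpa using (hasDerivAt_pow (N + 1) w).sub_const p
    have hg₁ : HasDerivAt (fun w : ℂ => ((N : ℂ) + 1) * w ^ N)
        (((N : ℂ) + 1) * (N * z ^ (N - 1))) z := (hasDerivAt_pow N z).const_mul _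
    have hexp : Real.exp (V z) =
        Real.exp μ / (1 + Real.exp μ / lam * ‖z ^ (N + 1) - p‖ ^ 2) ^ 2 := by
      have := hD z
      rw [hV, Real.exp_log (by positivity)]
    have hN : ‖(N : ℂ) + 1‖ = (N : ℝ) + 1 := by
      exact_mod_cast Complex.norm_natCast (N + 1)
    rw [hexp, hV', lapC_liouville μ _ hc _ _ _ z hg hg₁, norm_mul, norm_pow, hN]
    ring
end

section
/- Let N be a natural number, λ > 0, μ ∈ ℝ, p ∈ ℂ, and let V_{μ,p}(z) = log( e^μ / (1 + (e^μ/λ)|z^{N+1} − p|²)² ). Then the weighted exponential is integrable and ∫_{ℂ} (8(N+1)²/λ)·|z|^{2N}·e^{V_{μ,p}(z)} dz = 8π(N+1). -/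
open Real MeasureTheory

/-- The determinant over `ℝ` of multiplication by a complex number is its squared norm. -/
theorem Complex.det_smul_one (c : ℂ) : (c • (1 : ℂ →L[ℝ] ℂ)).det = ‖c‖ ^ 2 := by
  rw [← Complex.normSq_eq_norm_sq, ← Algebra.norm_complex_apply, Algebra.norm_apply,
    ContinuousLinearMap.det]
  congr 1

/-- Change of variables along the `n`-sheeted cover `z ↦ z ^ n`. -/
theorem lintegral_norm_deriv_pow_mul_comp_pow {n : ℕ} (hn : n ≠ 0) (g : ℂ → ENNReal) :
    ∫⁻ z : ℂ, ENNReal.ofReal (‖(n : ℂ) * z ^ (n - 1)‖ ^ 2) * g (z ^ n) = n * ∫⁻ w : ℂ, g w := by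
  set sheet : ℂ → Set ℂ := fun ζ ↦ {z | z ≠ 0 ∧ z = ζ * (z ^ n) ^ (n⁻¹ : ℂ)}
  set R := Polynomial.nthRootsFinset n (1 : ℂ)
  have hR (ζ : ℂ) : ζ ∈ R ↔ ζ ^ n = 1 := Polynomial.mem_nthRootsFinset hn.bot_lt 1
  have hroot (w : ℂ) : (w ^ (n⁻¹ : ℂ)) ^ n = w := Complex.cpow_nat_inv_pow w hn
  have hmeas (ζ : ℂ) : MeasurableSet (sheet ζ) :=
    (measurableSet_singleton (0 : ℂ)).compl.inter
      (measurableSet_eq_fun measurable_id (by fun_prop))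
  have hinj (ζ : ℂ) : Set.InjOn (fun z : ℂ ↦ z ^ n) (sheet ζ) := by
    intro z hz w hw h
    rw [hz.2, hw.2]
    simp only at h
    rw [h]
  have himage (ζ : ℂ) (hζ : ζ ∈ R) : (fun z : ℂ ↦ z ^ n) '' sheet ζ = {0}ᶜ := by
    rw [hR] at hζ
    ext w
    simp only [Set.mem_image, Set.mem_compl_iff, Set.mem_singleton_iff]
    refine ⟨?_, fun hw ↦ ⟨ζ * w ^ (n⁻¹ : ℂ), ?_, by rw [mul_pow, hζ, hroot, one_mul]⟩⟩
    · rintro ⟨z, hz, rfl⟩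
      exact pow_ne_zero n hz.1
    · have hpow : (ζ * w ^ (n⁻¹ : ℂ)) ^ n = w := by rw [mul_pow, hζ, hroot, one_mul]
      exact ⟨fun h ↦ hw (by rw [← hpow, h, zero_pow hn]), by rw [hpow]⟩
  have hcover : ⋃ ζ ∈ R, sheet ζ = {0}ᶜ := by
    ext z
    simp only [Set.mem_iUnion, Set.mem_compl_iff, Set.mem_singleton_iff]
    refine ⟨fun ⟨_, _, h⟩ ↦ h.1, fun hz ↦ ?_⟩
    have hne : (z ^ n) ^ (n⁻¹ : ℂ) ≠ 0 := fun h ↦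
      pow_ne_zero n hz (by rw [← hroot (z ^ n), h, zero_pow hn])
    refine ⟨z / (z ^ n) ^ (n⁻¹ : ℂ), ?_, hz, (div_mul_cancel₀ z hne).symm⟩
    rw [hR, div_pow, hroot, div_self (pow_ne_zero n hz)]
  have hdisj : Set.PairwiseDisjoint (R : Set ℂ) sheet := by
    intro ζ _ ξ _ hne
    refine Set.disjoint_left.2 fun z hz hz' ↦ hne ?_
    have h := hz.2.symm.trans hz'.2
    exact mul_right_cancel₀ (fun h0 ↦ hz.1 (by rw [hz.2, h0, mul_zero])) h
  have hcompl : ({0}ᶜ : Set ℂ) =ᵐ[volume] Set.univ := by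
    rw [ae_eq_univ, compl_compl, measure_singleton]
  have hcard : R.card = n := (Complex.isPrimitiveRoot_exp n hn).card_nthRootsFinset
  have hsheet_int (ζ : ℂ) (hζ : ζ ∈ R) :
      ∫⁻ z in sheet ζ, ENNReal.ofReal (‖(n : ℂ) * z ^ (n - 1)‖ ^ 2) * g (z ^ n) =
        ∫⁻ w : ℂ, g w := by
    rw [← setLIntegral_univ g, ← setLIntegral_congr hcompl, ← himage ζ hζ,
      lintegral_image_eq_lintegral_abs_det_fderiv_mul volume (hmeas ζ)
        (fun z _ ↦ (hasDerivAt_pow n z).complexToReal_fderiv.hasFDerivWithinAt) (hinj ζ)]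
    simp only [Complex.det_smul_one, abs_pow, abs_norm]
  rw [← setLIntegral_univ, ← setLIntegral_congr hcompl, ← hcover,
    lintegral_biUnion_finset hdisj (fun ζ _ ↦ hmeas ζ), Finset.sum_congr rfl hsheet_int,
    Finset.sum_const, hcard, nsmul_eq_mul]

/-- The radial profile of the Liouville bubble has integral `4`. -/
theorem lintegral_Ioi_liouville_profile {a : ℝ} (ha : 0 < a) :
    ∫⁻ r in Set.Ioi (0 : ℝ), ENNReal.ofReal (r * (8 * a / (1 + a * r ^ 2) ^ 2)) =
      ENNReal.ofReal 4 := by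
  have hderiv (r : ℝ) : HasDerivAt (fun r : ℝ ↦ -4 * (1 + a * r ^ 2)⁻¹)
      (r * (8 * a / (1 + a * r ^ 2) ^ 2)) r := by
    have hpos : 1 + a * r ^ 2 ≠ 0 := by positivity
    refine ((((hasDerivAt_pow 2 r).const_mul a).const_add 1).fun_inv hpos).const_mul (-4)
      |>.congr_deriv ?_
    field_simp
    norm_num
    ring
  have hnonneg : ∀ r ∈ Set.Ioi (0 : ℝ), 0 ≤ r * (8 * a / (1 + a * r ^ 2) ^ 2) := by
    intro r (hr : 0 < r)
    positivity
  have hlim : Filter.Tendsto (fun r : ℝ ↦ -4 * (1 + a * r ^ 2)⁻¹) Filter.atTop (nhds 0) := by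
    have : Filter.Tendsto (fun r : ℝ ↦ 1 + a * r ^ 2) Filter.atTop Filter.atTop :=
      Filter.tendsto_atTop_add_const_left _ _
        ((Filter.tendsto_pow_atTop two_ne_zero).const_mul_atTop ha)
    simpa using this.inv_tendsto_atTop.const_mul (-4)
  rw [← ofReal_integral_eq_lintegral_ofReal
      (integrableOn_Ioi_deriv_of_nonneg' (fun r _ ↦ hderiv r) hnonneg hlim)
      (ae_restrict_of_forall_mem measurableSet_Ioi hnonneg),
    integral_Ioi_of_hasDerivAt_of_nonneg' (fun r _ ↦ hderiv r) hnonneg hlim]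
  norm_num

/-- The planar Liouville bubble has total mass `8π`. -/
theorem lintegral_liouville_bubble {a : ℝ} (ha : 0 < a) (p : ℂ) :
    ∫⁻ w : ℂ, ENNReal.ofReal (8 * a / (1 + a * ‖w - p‖ ^ 2) ^ 2) = ENNReal.ofReal (8 * π) := by
  rw [lintegral_sub_right_eq_self
      (fun w : ℂ ↦ ENNReal.ofReal (8 * a / (1 + a * ‖w‖ ^ 2) ^ 2)) p,
    ← Complex.lintegral_comp_polarCoord_symm]
  have hradial : ∀ q ∈ polarCoord.target,
      ENNReal.ofReal q.1 •
        ENNReal.ofReal (8 * a / (1 + a * ‖Complex.polarCoord.symm q‖ ^ 2) ^ 2) =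
      ENNReal.ofReal (q.1 * (8 * a / (1 + a * q.1 ^ 2) ^ 2)) * 1 := by
    intro q hq
    have hq_pos : 0 < q.1 := hq.1
    rw [Complex.norm_polarCoord_symm, sq_abs, smul_eq_mul, ← ENNReal.ofReal_mul hq_pos.le, mul_one]
  rw [setLIntegral_congr_fun polarCoord.open_target.measurableSet hradial, polarCoord_target,
    Measure.volume_eq_prod, ← Measure.prod_restrict,
    lintegral_prod_mul (f := fun r : ℝ ↦ ENNReal.ofReal (r * (8 * a / (1 + a * r ^ 2) ^ 2)))
      (g := fun _ : ℝ ↦ 1) (by fun_prop) (by fun_prop),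
    lintegral_Ioi_liouville_profile ha, setLIntegral_one, Real.volume_Ioo,
    ← ENNReal.ofReal_mul (by norm_num)]
  ring_nf

/-- total mass of the singular Liouville bubble
`V_{μ,p}(z) = log (e^μ / (1 + (e^μ/λ)|z^{N+1} − p|²)²)`:
`∫_ℂ (8(N+1)²/λ) |z|^{2N} e^{V_{μ,p}} = 8π(N+1)`. -/
theorem singular_liouville_total_mass (N : ℕ) (lam μ : ℝ) (hlam : 0 < lam) (p : ℂ)
    (V : ℂ → ℝ)
    (hV : ∀ z : ℂ,
      V z = Real.log (Real.exp μ / (1 + Real.exp μ / lam * ‖z ^ (N + 1) - p‖ ^ 2) ^ 2)) :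
    Integrable (fun z : ℂ => 8 * ((N : ℝ) + 1) ^ 2 / lam * ‖z‖ ^ (2 * N) * Real.exp (V z))
      volume ∧
    (∫ z : ℂ, 8 * ((N : ℝ) + 1) ^ 2 / lam * ‖z‖ ^ (2 * N) * Real.exp (V z)) =
      8 * π * ((N : ℝ) + 1) := by
  set a := Real.exp μ / lam with ha_def
  have ha : 0 < a := by positivity
  have hdensity (z : ℂ) :
      8 * ((N : ℝ) + 1) ^ 2 / lam * ‖z‖ ^ (2 * N) * Real.exp (V z) =
        ‖((N + 1 : ℕ) : ℂ) * z ^ N‖ ^ 2 * (8 * a / (1 + a * ‖z ^ (N + 1) - p‖ ^ 2) ^ 2) := by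
    rw [hV, Real.exp_log (by positivity), norm_mul, norm_pow, Complex.norm_natCast, ha_def]
    push_cast
    ring
  simp only [hdensity]
  set F : ℂ → ℝ := fun z ↦
    ‖((N + 1 : ℕ) : ℂ) * z ^ N‖ ^ 2 * (8 * a / (1 + a * ‖z ^ (N + 1) - p‖ ^ 2) ^ 2)
  have hF_nonneg : 0 ≤ F := fun z ↦ by positivity
  have hF_meas : AEStronglyMeasurable F volume :=
    Measurable.aestronglyMeasurable (by fun_prop)
  have hmass : ∫⁻ z, ENNReal.ofReal (F z) = ENNReal.ofReal (8 * π * ((N : ℝ) + 1)) := by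
    have h := lintegral_norm_deriv_pow_mul_comp_pow N.succ_ne_zero
      (fun w ↦ ENNReal.ofReal (8 * a / (1 + a * ‖w - p‖ ^ 2) ^ 2))
    rw [lintegral_liouville_bubble ha, ← ENNReal.ofReal_natCast,
      ← ENNReal.ofReal_mul (Nat.cast_nonneg _)] at h
    simp only [F, ENNReal.ofReal_mul (sq_nonneg _)]
    refine h.trans ?_
    push_cast
    ring_nf
  constructor
  · refine ⟨hF_meas, ?_⟩
    rw [hasFiniteIntegral_iff_ofReal (.of_forall hF_nonneg), hmass]
    exact ENNReal.ofReal_lt_top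
  · rw [integral_eq_lintegral_of_nonneg_ae (.of_forall hF_nonneg) hF_meas, hmass,
      ENNReal.toReal_ofReal (by positivity)]
end

section
/- Let N be a natural number, λ > 0, μ ∈ ℝ, p ∈ ℂ, set a = e^μ/λ, and let V_{μ,p}(z) = μ − 2·log(1 + a|z^{N+1} − p|²). Define φ(z) = (1 − a|z^{N+1} − p|²)/(1 + a|z^{N+1} − p|²) (which equals the derivative of V_{μ,p} with respect to the parameter μ). Then φ satisfies the linearized Liouville equation Δφ(z) + (8(N+1)²/λ)·|z|^{2N}·e^{V_{μ,p}(z)}·φ(z) = 0 for every z ∈ ℂ. -/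
open Real

lemma HasFDerivAt.div_of_real {E : Type*} [NormedAddCommGroup E] [NormedSpace ℝ E]
    {u v : E → ℝ} {u' v' : E →L[ℝ] ℝ} {z : E} (hu : HasFDerivAt u u' z)
    (hv : HasFDerivAt v v' z) (hne : v z ≠ 0) :
    HasFDerivAt (fun w => u w / v w) ((v z ^ 2)⁻¹ • (v z • u' - u z • v')) z := by
  have h := hu.fun_mul ((hasDerivAt_inv hne).comp_hasFDerivAt z hv)
  simp only [div_eq_mul_inv]
  refine h.congr_fderiv ?_
  ext x
  simp
  field_simp
  ring

lemma HasDerivAt.hasFDerivAt_re {f : ℂ → ℂ} {f' z : ℂ} (hf : HasDerivAt f f' z) :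
    HasFDerivAt (fun w => (f w).re)
      (Complex.reCLM ∘L (ContinuousLinearMap.toSpanSingleton ℂ f').restrictScalars ℝ) z :=
  Complex.reCLM.hasFDerivAt.comp z (hf.hasFDerivAt.restrictScalars ℝ)

lemma HasDerivAt.hasFDerivAt_im {f : ℂ → ℂ} {f' z : ℂ} (hf : HasDerivAt f f' z) :
    HasFDerivAt (fun w => (f w).im)
      (Complex.imCLM ∘L (ContinuousLinearMap.toSpanSingleton ℂ f').restrictScalars ℝ) z :=
  Complex.imCLM.hasFDerivAt.comp z (hf.hasFDerivAt.restrictScalars ℝ)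

/-- Directional derivative of the pullback of `(1 - a|w|²)/(1 + a|w|²)` by a holomorphic map. -/
lemma fderiv_radial_comp {a : ℝ} (ha : 0 ≤ a) {f : ℂ → ℂ} {f' z : ℂ}
    (hf : HasDerivAt f f' z) (v : ℂ) :
    fderiv ℝ (fun w => (1 - a * ‖f w‖ ^ 2) / (1 + a * ‖f w‖ ^ 2)) z v =
      -4 * a * ((f z).re * (f' * v).re + (f z).im * (f' * v).im) /
        (1 + a * ((f z).re * (f z).re + (f z).im * (f z).im)) ^ 2 := by
  have hpos : 0 < 1 + a * ((f z).re * (f z).re + (f z).im * (f z).im) := by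
    have := mul_nonneg ha (add_nonneg (mul_self_nonneg (f z).re) (mul_self_nonneg (f z).im))
    linarith
  have hq := ((hf.hasFDerivAt_re.fun_mul hf.hasFDerivAt_re).fun_add
    (hf.hasFDerivAt_im.fun_mul hf.hasFDerivAt_im)).const_mul a
  have h := (hq.const_sub 1).div_of_real (hq.const_add 1) hpos.ne'
  simp only [← Complex.normSq_eq_norm_sq, Complex.normSq_apply]
  rw [h.fderiv]
  simp
  field_simp
  ring

/-- Second directional derivative of the pullback of `(1 - a|w|²)/(1 + a|w|²)` by a holomorphic
map `f` with `f' = g` and `g' = g'`. -/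
lemma fderiv_fderiv_radial_comp {a : ℝ} (ha : 0 ≤ a) {f g : ℂ → ℂ} {g' z : ℂ}
    (hf : ∀ w, HasDerivAt f (g w) w) (hg : HasDerivAt g g' z) (v : ℂ) :
    fderiv ℝ (fun w =>
        fderiv ℝ (fun w => (1 - a * ‖f w‖ ^ 2) / (1 + a * ‖f w‖ ^ 2)) w v) z v =
      -4 * a * ((g z * v).re ^ 2 + (g z * v).im ^ 2 +
          (f z).re * (g' * v * v).re + (f z).im * (g' * v * v).im) / (1 + a * ‖f z‖ ^ 2) ^ 2 +
        16 * a ^ 2 * ((f z).re * (g z * v).re + (f z).im * (g z * v).im) ^ 2 /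
          (1 + a * ‖f z‖ ^ 2) ^ 3 := by
  have hpos : 0 < 1 + a * ((f z).re * (f z).re + (f z).im * (f z).im) := by
    have := mul_nonneg ha (add_nonneg (mul_self_nonneg (f z).re) (mul_self_nonneg (f z).im))
    linarith
  have hgv := hg.mul_const v
  have hre := (hf z).hasFDerivAt_re
  have him := (hf z).hasFDerivAt_im
  have hq := ((hre.fun_mul hre).fun_add (him.fun_mul him)).const_mul a
  have hnum := ((hre.fun_mul hgv.hasFDerivAt_re).fun_add
    (him.fun_mul hgv.hasFDerivAt_im)).const_mul (-4 * a)
  have h := hnum.div_of_real ((hq.const_add 1).pow 2) (pow_ne_zero 2 hpos.ne')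
  simp only [fun w => fderiv_radial_comp ha (hf w) v]
  simp only [← Complex.normSq_eq_norm_sq, Complex.normSq_apply]
  rw [h.fderiv]
  have e1 : v * g z = g z * v := mul_comm _ _
  have e2 : v * (g' * v) = g' * v * v := mul_comm _ _
  simp only [smul_apply, add_apply,
    sub_apply, ContinuousLinearMap.comp_apply,
    ContinuousLinearMap.coe_restrictScalars', ContinuousLinearMap.toSpanSingleton_apply,
    Complex.reCLM_apply, Complex.imCLM_apply, smul_eq_mul, nsmul_eq_mul, e1, e2]
  generalize (g z * v).re = A
  generalize (g z * v).im = B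
  generalize (g' * v * v).re = C
  generalize (g' * v * v).im = D
  field_simp
  ring

/-- The function `(1 - a|w|²)/(1 + a|w|²)`, pulled back by a holomorphic map `f`, is an
eigenfunction of the Laplacian for the pulled back round metric. -/
lemma lapC_radial_comp {a : ℝ} (ha : 0 ≤ a) {f g : ℂ → ℂ} {g' z : ℂ}
    (hf : ∀ w, HasDerivAt f (g w) w) (hg : HasDerivAt g g' z) :
    lapC (fun w => (1 - a * ‖f w‖ ^ 2) / (1 + a * ‖f w‖ ^ 2)) z =
      -8 * a * ‖g z‖ ^ 2 / (1 + a * ‖f z‖ ^ 2) ^ 2 *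
        ((1 - a * ‖f z‖ ^ 2) / (1 + a * ‖f z‖ ^ 2)) := by
  have hpos : 0 < 1 + a * ‖f z‖ ^ 2 := by positivity
  rw [lapC, fderiv_fderiv_radial_comp ha hf hg, fderiv_fderiv_radial_comp ha hf hg]
  simp only [← Complex.normSq_eq_norm_sq, Complex.normSq_apply] at hpos ⊢
  simp only [mul_one, Complex.mul_re, Complex.mul_im, Complex.I_re, Complex.I_im]
  field_simp
  ring

/-- `φ = ∂_μ V_{μ,p}` solves the linearized Liouville equation
`Δφ + (8(N+1)²/λ)|z|^{2N} e^{V_{μ,p}} φ = 0` on ℂ. -/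
theorem linearized_liouville_radial_kernel (N : ℕ) (lam μ a : ℝ) (hlam : 0 < lam) (p : ℂ)
    (ha : a = Real.exp μ / lam) (V φ : ℂ → ℝ)
    (hV : ∀ z : ℂ, V z = μ - 2 * Real.log (1 + a * ‖z ^ (N + 1) - p‖ ^ 2))
    (hphi : ∀ z : ℂ,
      φ z = (1 - a * ‖z ^ (N + 1) - p‖ ^ 2) / (1 + a * ‖z ^ (N + 1) - p‖ ^ 2)) :
    ∀ z : ℂ,
      lapC φ z + 8 * ((N : ℝ) + 1) ^ 2 / lam * ‖z‖ ^ (2 * N) * Real.exp (V z) * φ z = 0 := by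
  intro z
  have ha0 : 0 ≤ a := by rw [ha]; positivity
  have hpos : 0 < 1 + a * ‖z ^ (N + 1) - p‖ ^ 2 := by positivity
  have hf : ∀ w : ℂ, HasDerivAt (fun w : ℂ => w ^ (N + 1) - p) ((N + 1 : ℂ) * w ^ N) w := by
    intro w
    simpa using (hasDerivAt_pow (N + 1) w).sub_const p
  have hg := (hasDerivAt_pow N z).const_mul (N + 1 : ℂ)
  have hexp : Real.exp (V z) = lam * a / (1 + a * ‖z ^ (N + 1) - p‖ ^ 2) ^ 2 := by
    have h2 : 2 * Real.log (1 + a * ‖z ^ (N + 1) - p‖ ^ 2) =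
        Real.log ((1 + a * ‖z ^ (N + 1) - p‖ ^ 2) ^ 2) := by simp [Real.log_pow]
    rw [hV, h2, Real.exp_sub, Real.exp_log (by positivity), ha]
    field_simp
  have hnorm : ‖(N + 1 : ℂ) * z ^ N‖ ^ 2 = ((N : ℝ) + 1) ^ 2 * ‖z‖ ^ (2 * N) := by
    have hN : ‖(N + 1 : ℂ)‖ = (N : ℝ) + 1 := by exact_mod_cast Complex.norm_natCast (N + 1)
    rw [norm_mul, norm_pow, hN]
    ring
  rw [funext hphi, lapC_radial_comp ha0 hf hg, hexp, hnorm]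
  field_simp
  ring
end

section
/- Let N be a natural number, λ > 0, μ ∈ ℝ, p ∈ ℂ, set a = e^μ/λ, and define φ(z) = (1 − a|z^{N+1} − p|²)/(1 + a|z^{N+1} − p|²). Then the radial derivative of φ decays like |z|^{−2N−3}: there exist constants C > 0 and R > 0 such that for all z with |z| ≥ R, |(z/|z|) · ∇φ(z)| ≤ C|z|^{−2N−3}. -/
open Real

lemma hasDerivAt_one_sub_mul_div_one_add_mul {a s : ℝ} (h : 1 + a * s ≠ 0) :
    HasDerivAt (fun s : ℝ => (1 - a * s) / (1 + a * s)) (-(2 * a) / (1 + a * s) ^ 2) s := by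
  have hm : HasDerivAt (fun s : ℝ => a * s) a s := by
    simpa using (hasDerivAt_id s).const_mul a
  refine ((hm.const_sub 1).div (hm.const_add 1) h).congr_deriv ?_
  ring

lemma abs_fderiv_one_sub_mul_norm_sq_div_le {E F : Type*} [NormedAddCommGroup E] [NormedSpace ℝ E]
    [NormedAddCommGroup F] [InnerProductSpace ℝ F] {a : ℝ} (ha : 0 ≤ a) {f : E → F}
    {f' : E →L[ℝ] F} {x : E} (hf : HasFDerivAt f f' x) (v : E) :
    |fderiv ℝ (fun y => (1 - a * ‖f y‖ ^ 2) / (1 + a * ‖f y‖ ^ 2)) x v| ≤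
      4 * a * ‖f x‖ * ‖f' v‖ / (1 + a * ‖f x‖ ^ 2) ^ 2 := by
  have hpos : 0 < 1 + a * ‖f x‖ ^ 2 := by positivity
  have hD := (hasDerivAt_one_sub_mul_div_one_add_mul hpos.ne').comp_hasFDerivAt x hf.norm_sq
  have heq : fderiv ℝ (fun y => (1 - a * ‖f y‖ ^ 2) / (1 + a * ‖f y‖ ^ 2)) x v =
      -(2 * a) / (1 + a * ‖f x‖ ^ 2) ^ 2 * (2 * inner ℝ (f x) (f' v)) := by
    have h := hD.fderiv
    simp only [Function.comp_def] at h
    rw [h]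
    simp
  rw [heq, abs_mul, abs_div, abs_neg, abs_mul, abs_mul, abs_of_nonneg ha,
    abs_of_pos (pow_pos hpos 2), abs_two]
  calc _ ≤ 2 * a / (1 + a * ‖f x‖ ^ 2) ^ 2 * (2 * (‖f x‖ * ‖f' v‖)) := by
        gcongr
        exact abs_real_inner_le_norm _ _
    _ = _ := by ring

/-- the radial derivative of
`φ(z) = (1 − a|z^{N+1} − p|²)/(1 + a|z^{N+1} − p|²)` decays like `|z|^{−2N−3}`. -/
theorem radial_derivative_decay (N : ℕ) (lam μ a : ℝ) (hlam : 0 < lam) (p : ℂ)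
    (ha : a = Real.exp μ / lam) (φ : ℂ → ℝ)
    (hphi : ∀ z : ℂ,
      φ z = (1 - a * ‖z ^ (N + 1) - p‖ ^ 2) / (1 + a * ‖z ^ (N + 1) - p‖ ^ 2)) :
    ∃ C > (0 : ℝ), ∃ R > (0 : ℝ), ∀ z : ℂ, R ≤ ‖z‖ →
      |fderiv ℝ φ z (‖z‖⁻¹ • z)| ≤ C / ‖z‖ ^ (2 * N + 3) := by
  have ha0 : 0 < a := by rw [ha]; positivity
  refine ⟨32 * (N + 1) / a, by positivity, 1 + 2 * ‖p‖, by positivity, fun z hz => ?_⟩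
  have hz1 : 1 ≤ ‖z‖ := by linarith [norm_nonneg p]
  have hz0 : 0 < ‖z‖ := by linarith
  have hf : HasFDerivAt (fun y : ℂ => y ^ (N + 1) - p) _ z :=
    (((hasDerivAt_pow (N + 1) z).sub_const p).hasFDerivAt).restrictScalars ℝ
  have hbound := abs_fderiv_one_sub_mul_norm_sq_div_le ha0.le hf (‖z‖⁻¹ • z)
  rw [← funext hphi] at hbound
  refine hbound.trans ?_
  have hv : ‖(ContinuousLinearMap.toSpanSingleton ℂ
      (((N + 1 : ℕ) : ℂ) * z ^ (N + 1 - 1))).restrictScalars ℝ (‖z‖⁻¹ • z)‖ =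
      (N + 1) * ‖z‖ ^ N := by
    have hn : ‖((N + 1 : ℕ) : ℂ)‖ = N + 1 := by
      rw [Complex.norm_natCast]; push_cast; rfl
    simp only [ContinuousLinearMap.coe_restrictScalars', ContinuousLinearMap.toSpanSingleton_apply,
      smul_eq_mul, norm_mul, norm_smul, norm_inv, norm_norm, norm_pow, hn, Nat.add_sub_cancel]
    field_simp
  rw [hv]
  set d := ‖z ^ (N + 1) - p‖
  have hd : ‖z‖ ^ (N + 1) / 2 ≤ d := by
    have h1 : ‖z ^ (N + 1)‖ - ‖p‖ ≤ d := norm_sub_norm_le _ _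
    have h2 : ‖z‖ ≤ ‖z‖ ^ (N + 1) := le_self_pow₀ hz1 (by omega)
    rw [norm_pow] at h1
    linarith
  have hd0 : 0 < d := lt_of_lt_of_le (by positivity) hd
  calc 4 * a * d * ((N + 1) * ‖z‖ ^ N) / (1 + a * d ^ 2) ^ 2
      ≤ 4 * a * d * ((N + 1) * ‖z‖ ^ N) / (a * d ^ 2) ^ 2 := by
        gcongr
        linarith
    _ = 4 * (N + 1) * ‖z‖ ^ N / (a * d ^ 3) := by field_simp
    _ ≤ 4 * (N + 1) * ‖z‖ ^ N / (a * (‖z‖ ^ (N + 1) / 2) ^ 3) := by gcongr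
    _ = 32 * (N + 1) / a / ‖z‖ ^ (2 * N + 3) := by
        field_simp
        ring
end

section
/- Let N be a natural number, a > 0, and P ∈ ℂ. Then ∫_{ℂ} ( (1 − a|z^{N+1} − P|²)·|z|^{2N} / (1 + a|z^{N+1} − P|²)³ ) dz = 0. -/
open Real MeasureTheory

open ComplexConjugate in
theorem one_add_mul_mul_conj (a : ℝ) (q : ℂ) :
    1 + (a : ℂ) * (q * conj q) = ((1 + a * ‖q‖ ^ 2 : ℝ) : ℂ) := by
  rw [Complex.mul_conj']
  push_cast
  ring

/-- The kernel denominator controls the `2n`-th power of `1 + ‖z‖`. -/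
theorem exists_one_add_norm_pow_le (n : ℕ) {a : ℝ} (ha : 0 < a) (P : ℂ) :
    ∃ K : ℝ, 0 < K ∧ ∀ z : ℂ, (1 + ‖z‖) ^ (2 * n) ≤ K * (1 + a * ‖z ^ n - P‖ ^ 2) := by
  refine ⟨(2 ^ (n - 1)) ^ 2 * (2 * ((1 + ‖P‖) ^ 2 + 1 / a)), by positivity, fun z => ?_⟩
  have h1 : (1 + ‖z‖) ^ n ≤ 2 ^ (n - 1) * (1 + ‖P‖ + ‖z ^ n - P‖) := by
    refine (add_pow_le zero_le_one (norm_nonneg z) n).trans ?_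
    have := norm_add_le (z ^ n - P) P
    rw [sub_add_cancel, norm_pow] at this
    refine mul_le_mul_of_nonneg_left ?_ (by positivity)
    rw [one_pow]
    linarith
  set q := ‖z ^ n - P‖
  set p := 1 + ‖P‖
  have h2 : (p + q) ^ 2 ≤ 2 * (p ^ 2 + 1 / a) * (1 + a * q ^ 2) := by
    have e : (p ^ 2 + 1 / a) * (1 + a * q ^ 2) = p ^ 2 + q ^ 2 + (p ^ 2 * (a * q ^ 2) + 1 / a) := by
      field_simp
      ring
    have : 0 ≤ p ^ 2 * (a * q ^ 2) + 1 / a := by positivity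
    nlinarith [sq_nonneg (p - q)]
  calc (1 + ‖z‖) ^ (2 * n) = ((1 + ‖z‖) ^ n) ^ 2 := by rw [← pow_mul, mul_comm]
    _ ≤ (2 ^ (n - 1) * (p + q)) ^ 2 := by gcongr
    _ = (2 ^ (n - 1)) ^ 2 * (p + q) ^ 2 := by ring
    _ ≤ (2 ^ (n - 1)) ^ 2 * (2 * (p ^ 2 + 1 / a) * (1 + a * q ^ 2)) := by gcongr
    _ = _ := by ring

open ComplexConjugate in
theorem integrable_monomial_div_pow (n : ℕ) {a : ℝ} (ha : 0 < a) (P : ℂ) (i j k l m : ℕ)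
    (hd : i + j + n * (k + l) + 3 ≤ 2 * n * m) :
    Integrable (fun z : ℂ => conj z ^ i * z ^ j * (z ^ n - P) ^ k * conj (z ^ n - P) ^ l /
      (1 + (a : ℂ) * ((z ^ n - P) * conj (z ^ n - P))) ^ m) := by
  obtain ⟨K, hK, hle⟩ := exists_one_add_norm_pow_le n ha P
  have hne (z : ℂ) : (1 + (a : ℂ) * ((z ^ n - P) * conj (z ^ n - P))) ^ m ≠ 0 := by
    rw [one_add_mul_mul_conj, ← Complex.ofReal_pow, Complex.ofReal_ne_zero]
    positivity
  have hfin : (Module.finrank ℝ ℂ : ℝ) < (3 : ℝ) := by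
    rw [Complex.finrank_real_complex]
    norm_num
  refine ((integrable_one_add_norm (μ := volume) hfin).const_mul
    ((1 + ‖P‖) ^ (k + l) * K ^ m)).mono' ?_ (.of_forall fun z => ?_)
  · refine Continuous.aestronglyMeasurable (Continuous.div ?_ ?_ hne) <;>
      fun_prop
  · have hD : 0 < 1 + a * ‖z ^ n - P‖ ^ 2 := by positivity
    have hq : ‖z ^ n - P‖ ≤ (1 + ‖P‖) * (1 + ‖z‖) ^ n := by
      have h1 : ‖z‖ ^ n ≤ (1 + ‖z‖) ^ n := by gcongr; linarith
      have h2 : 1 ≤ (1 + ‖z‖) ^ n := one_le_pow₀ (by linarith [norm_nonneg z])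
      have h3 := norm_sub_le (z ^ n) P
      rw [norm_pow] at h3
      nlinarith [norm_nonneg P]
    have hz : ‖z‖ ≤ 1 + ‖z‖ := by linarith
    have hr : (1 + ‖z‖) ^ (-(3 : ℝ)) = 1 / (1 + ‖z‖) ^ 3 := by
      rw [Real.rpow_neg (by positivity), one_div]
      norm_cast
    rw [one_add_mul_mul_conj, hr, norm_div, norm_pow (Complex.ofReal _), Complex.norm_real,
      Real.norm_of_nonneg hD.le]
    simp only [norm_mul, norm_pow, RCLike.norm_conj]
    rw [mul_one_div, div_le_div_iff₀ (by positivity) (by positivity)]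
    calc ‖z‖ ^ i * ‖z‖ ^ j * ‖z ^ n - P‖ ^ k * ‖z ^ n - P‖ ^ l * (1 + ‖z‖) ^ 3
        ≤ (1 + ‖z‖) ^ i * (1 + ‖z‖) ^ j * ((1 + ‖P‖) * (1 + ‖z‖) ^ n) ^ k *
            ((1 + ‖P‖) * (1 + ‖z‖) ^ n) ^ l * (1 + ‖z‖) ^ 3 := by gcongr
      _ = (1 + ‖P‖) ^ (k + l) * (1 + ‖z‖) ^ (i + j + n * (k + l) + 3) := by
          simp only [mul_pow, ← pow_mul]
          ring
      _ ≤ (1 + ‖P‖) ^ (k + l) * (1 + ‖z‖) ^ (2 * n * m) := by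
          gcongr
          linarith [norm_nonneg z]
      _ = (1 + ‖P‖) ^ (k + l) * ((1 + ‖z‖) ^ (2 * n)) ^ m := by rw [pow_mul]
      _ ≤ (1 + ‖P‖) ^ (k + l) * (K * (1 + a * ‖z ^ n - P‖ ^ 2)) ^ m := by
          gcongr
          exact hle z
      _ = _ := by rw [mul_pow, mul_assoc]

/-- An integrable line derivative of an integrable function has integral zero. -/
theorem integral_eq_zero_of_hasLineDerivAt {E G : Type*} [NormedAddCommGroup E] [NormedSpace ℝ E]
    [MeasurableSpace E] [BorelSpace E] [FiniteDimensional ℝ E] {μ : Measure E}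
    [μ.IsAddHaarMeasure] [NormedAddCommGroup G] [NormedSpace ℝ G] {g g' : E → G} {v : E}
    (hg : Integrable g μ) (hg' : Integrable g' μ)
    (h : ∀ x, HasLineDerivAt ℝ g (g' x) x v) : ∫ x, g' x ∂μ = 0 := by
  have := integral_bilinear_hasLineDerivAt_right_eq_neg_left_of_integrable (μ := μ)
    (f := fun _ => (1 : ℝ)) (f' := fun _ => 0) (g := g) (g' := g') (v := v)
    (B := ContinuousLinearMap.lsmul ℝ ℝ) (by simp) (by simpa using hg') (by simpa using hg)
    (fun x _ => by simpa [HasLineDerivAt] using hasDerivAt_const (0 : ℝ) (1 : ℝ))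
    (fun x _ => h x)
  simpa using this

open ComplexConjugate in
theorem hasLineDerivAt_conj_pow_mul_div_sq (N : ℕ) {a : ℝ} (ha : 0 < a) (P v z : ℂ) :
    HasLineDerivAt ℝ (fun z : ℂ => conj z ^ N * (z ^ (N + 1) - P) /
      (1 + (a : ℂ) * ((z ^ (N + 1) - P) * conj (z ^ (N + 1) - P))) ^ 2)
      (N * conj v * (conj z ^ (N - 1) * z ^ 0 * (z ^ (N + 1) - P) ^ 1 * conj (z ^ (N + 1) - P) ^ 0 /
          (1 + (a : ℂ) * ((z ^ (N + 1) - P) * conj (z ^ (N + 1) - P))) ^ 2) +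
        (N + 1) * v * (conj z ^ N * z ^ N * (z ^ (N + 1) - P) ^ 0 * conj (z ^ (N + 1) - P) ^ 0 /
          (1 + (a : ℂ) * ((z ^ (N + 1) - P) * conj (z ^ (N + 1) - P))) ^ 2) -
        2 * a * (N + 1) * v *
          (conj z ^ N * z ^ N * (z ^ (N + 1) - P) ^ 1 * conj (z ^ (N + 1) - P) ^ 1 /
            (1 + (a : ℂ) * ((z ^ (N + 1) - P) * conj (z ^ (N + 1) - P))) ^ 3) -
        2 * a * (N + 1) * conj v *
          (conj z ^ (N + N) * z ^ 0 * (z ^ (N + 1) - P) ^ 2 * conj (z ^ (N + 1) - P) ^ 0 /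
            (1 + (a : ℂ) * ((z ^ (N + 1) - P) * conj (z ^ (N + 1) - P))) ^ 3)) z v := by
  have hne : 1 + (a : ℂ) * ((z ^ (N + 1) - P) * conj (z ^ (N + 1) - P)) ≠ 0 := by
    rw [one_add_mul_mul_conj, Complex.ofReal_ne_zero]
    positivity
  have hz : HasDerivAt (fun t : ℝ => z + t • v) v 0 := by
    simpa using ((hasDerivAt_id (0 : ℝ)).smul_const v).const_add z
  have hzc : HasDerivAt (fun t : ℝ => conj (z + t • v)) (conj v) 0 := hz.star
  have hq := (hz.fun_pow (N + 1)).sub_const P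
  have hqc : HasDerivAt (fun t : ℝ => conj ((z + t • v) ^ (N + 1) - P)) _ 0 := hq.star
  have hD := (((hq.fun_mul hqc).const_mul (a : ℂ)).const_add 1).fun_pow 2
  have := ((hzc.fun_pow N).fun_mul hq).fun_div hD (by simpa using pow_ne_zero 2 hne)
  refine this.congr_deriv ?_
  simp only [zero_smul, add_zero, star_mul', star_pow, star_natCast, Complex.star_def]
  set D := 1 + (a : ℂ) * ((z ^ (N + 1) - P) * conj (z ^ (N + 1) - P))
  simp only [Nat.add_sub_cancel]
  field_simp
  push_cast
  ring

open ComplexConjugate in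
theorem ofReal_radial_kernel_eq (N : ℕ) {a : ℝ} (ha : 0 < a) (P z : ℂ) :
    (((1 - a * ‖z ^ (N + 1) - P‖ ^ 2) * ‖z‖ ^ (2 * N) /
      (1 + a * ‖z ^ (N + 1) - P‖ ^ 2) ^ 3 : ℝ) : ℂ) =
      conj z ^ N * z ^ N * (z ^ (N + 1) - P) ^ 0 * conj (z ^ (N + 1) - P) ^ 0 /
        (1 + (a : ℂ) * ((z ^ (N + 1) - P) * conj (z ^ (N + 1) - P))) ^ 2 -
      2 * a * (conj z ^ N * z ^ N * (z ^ (N + 1) - P) ^ 1 * conj (z ^ (N + 1) - P) ^ 1 /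
        (1 + (a : ℂ) * ((z ^ (N + 1) - P) * conj (z ^ (N + 1) - P))) ^ 3) := by
  have hne : 1 + (a : ℂ) * ((z ^ (N + 1) - P) * conj (z ^ (N + 1) - P)) ≠ 0 := by
    rw [one_add_mul_mul_conj, Complex.ofReal_ne_zero]
    positivity
  push_cast
  rw [pow_mul, ← Complex.mul_conj', ← Complex.mul_conj']
  field_simp
  ring

open ComplexConjugate in
/-- The complex-linear part of a vanishing real-linear expression in `v` vanishes. -/
theorem eq_of_forall_conj_relation {p q a A B C D : ℂ} (hq : q ≠ 0)
    (h : ∀ v : ℂ, p * conj v * A + q * v * B - 2 * a * q * v * C - 2 * a * q * conj v * D = 0) :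
    B = 2 * a * C := by
  have e1 := h 1
  have e2 := h Complex.I
  rw [map_one] at e1
  rw [Complex.conj_I] at e2
  refine mul_left_cancel₀ (mul_ne_zero two_ne_zero hq) ?_
  linear_combination e1 - Complex.I * e2 -
    (p * A - q * B + 2 * a * q * C - 2 * a * q * D) * Complex.I_sq

open ComplexConjugate in
theorem integral_radial_terms_eq (N : ℕ) {a : ℝ} (ha : 0 < a) (P : ℂ) :
    (∫ z : ℂ, (conj z ^ N * z ^ N * (z ^ (N + 1) - P) ^ 0 * conj (z ^ (N + 1) - P) ^ 0 /
        (1 + (a : ℂ) * ((z ^ (N + 1) - P) * conj (z ^ (N + 1) - P))) ^ 2 : ℂ)) =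
      2 * (a : ℂ) * ∫ z : ℂ, conj z ^ N * z ^ N * (z ^ (N + 1) - P) ^ 1 * conj (z ^ (N + 1) - P) ^ 1 /
        (1 + (a : ℂ) * ((z ^ (N + 1) - P) * conj (z ^ (N + 1) - P))) ^ 3 := by
  have hm := integrable_monomial_div_pow (N + 1) ha P
  have h1 := hm (N - 1) 0 1 0 2 (by lia)
  have h2 := hm N N 0 0 2 (by lia)
  have h3 := hm N N 1 1 3 (by lia)
  have h4 := hm (N + N) 0 2 0 3 (by lia)
  have hV := hm N 0 1 0 2 (by lia)
  simp only [pow_zero, pow_one, mul_one] at hV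
  have h12 (v : ℂ) := (h1.const_mul (N * conj v)).add (h2.const_mul ((N + 1) * v))
  have h123 (v : ℂ) := (h12 v).sub (h3.const_mul (2 * a * (N + 1) * v))
  have h4' (v : ℂ) := h4.const_mul (2 * a * (N + 1) * conj v)
  have h0 (v : ℂ) := integral_eq_zero_of_hasLineDerivAt hV ((h123 v).sub (h4' v))
    (hasLineDerivAt_conj_pow_mul_div_sq N ha P v)
  simp only [integral_sub' (h123 _) (h4' _), integral_sub' (h12 _) (h3.const_mul _),
    integral_add' (h1.const_mul _) (h2.const_mul _), integral_const_mul] at h0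
  exact eq_of_forall_conj_relation (by norm_cast) h0

/-- the vanishing integral identity
`∫_ℂ (1 − a|z^{N+1} − P|²)|z|^{2N} / (1 + a|z^{N+1} − P|²)³ dz = 0`. -/
theorem vanishing_integral_radial_kernel (N : ℕ) (a : ℝ) (ha : 0 < a) (P : ℂ) :
    Integrable (fun z : ℂ =>
      (1 - a * ‖z ^ (N + 1) - P‖ ^ 2) * ‖z‖ ^ (2 * N) /
        (1 + a * ‖z ^ (N + 1) - P‖ ^ 2) ^ 3) volume ∧
    (∫ z : ℂ,
      (1 - a * ‖z ^ (N + 1) - P‖ ^ 2) * ‖z‖ ^ (2 * N) /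
        (1 + a * ‖z ^ (N + 1) - P‖ ^ 2) ^ 3) = 0 := by
  have hm := integrable_monomial_div_pow (N + 1) ha P
  have h2 := hm N N 0 0 2 (by lia)
  have h3 := (hm N N 1 1 3 (by lia)).const_mul (2 * a)
  constructor
  · have h := (h2.sub h3).re
    refine h.congr (.of_forall fun z => ?_)
    simp only [Pi.sub_apply, ← ofReal_radial_kernel_eq N ha P z]
    exact Complex.ofReal_re _
  · rw [← Complex.ofReal_eq_zero, ← integral_complex_ofReal]
    simp only [ofReal_radial_kernel_eq N ha P]
    rw [integral_sub h2 h3, integral_const_mul, integral_radial_terms_eq N ha P, sub_self]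
end

section
/- Let N be a natural number, a > 0, and P ∈ ℂ. Then the ℂ-valued integral ∫_{ℂ} ( (z^{N+1} − P)·|z|^{2N} / (1 + a|z^{N+1} − P|²)³ ) dz equals 0; equivalently, both the real and imaginary parts of the integrand integrate to zero over ℂ. -/
open Real MeasureTheory

/-- The nonzero points `z` which are `ζ` times the principal `n`-th root of `z ^ n`. -/
def Complex.powBranch (n : ℕ) (ζ : ℂ) : Set ℂ :=
  {z | z ≠ 0 ∧ z = (z ^ n) ^ ((n : ℂ)⁻¹) * ζ}

namespace Complex

variable {n : ℕ} {ζ : ℂ}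

theorem measurableSet_powBranch : MeasurableSet (powBranch n ζ) := by
  refine (measurableSet_singleton (0 : ℂ)).compl.inter (measurableSet_eq_fun measurable_id ?_)
  fun_prop

theorem injOn_pow_powBranch : Set.InjOn (fun z : ℂ => z ^ n) (powBranch n ζ) := by
  intro z hz w hw h
  rw [hz.2, hw.2]
  simp only at h
  rw [h]

theorem image_pow_powBranch (hn : n ≠ 0) (hζ : ζ ^ n = 1) :
    (fun z : ℂ => z ^ n) '' powBranch n ζ = {0}ᶜ := by
  have hζ0 : ζ ≠ 0 := by
    rintro rfl
    simp [hn] at hζ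
  ext w
  constructor
  · rintro ⟨z, hz, rfl⟩
    exact pow_ne_zero n hz.1
  · intro hw
    have hpow : (w ^ ((n : ℂ)⁻¹) * ζ) ^ n = w := by
      rw [mul_pow, cpow_nat_inv_pow _ hn, hζ, mul_one]
    refine ⟨w ^ ((n : ℂ)⁻¹) * ζ, ⟨?_, by rw [hpow]⟩, hpow⟩
    intro h
    rw [h, zero_pow hn] at hpow
    exact hw hpow.symm

theorem disjoint_powBranch {ξ : ℂ} (h : ζ ≠ ξ) :
    Disjoint (powBranch n ζ) (powBranch n ξ) := by
  rw [Set.disjoint_left]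
  rintro z ⟨hz, h₁⟩ ⟨-, h₂⟩
  refine h (mul_left_cancel₀ (a := (z ^ n) ^ ((n : ℂ)⁻¹)) ?_ (h₁.symm.trans h₂))
  intro h0
  rw [h0, zero_mul] at h₁
  exact hz h₁

theorem iUnion_powBranch (hn : n ≠ 0) {ζ : ℂ} (hζ : IsPrimitiveRoot ζ n) :
    ⋃ k : Fin n, powBranch n (ζ ^ (k : ℕ)) = {0}ᶜ := by
  have : NeZero n := ⟨hn⟩
  ext z
  simp only [Set.mem_iUnion, Set.mem_compl_iff, Set.mem_singleton_iff]
  constructor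
  · rintro ⟨k, hk⟩
    exact hk.1
  · intro hz
    have hroot : (z ^ n) ^ ((n : ℂ)⁻¹) ≠ 0 := by
      intro h
      have := cpow_nat_inv_pow (z ^ n) hn
      rw [h, zero_pow hn] at this
      exact pow_ne_zero n hz this.symm
    obtain ⟨k, hk, hk'⟩ := hζ.eq_pow_of_pow_eq_one (ξ := z / (z ^ n) ^ ((n : ℂ)⁻¹)) (by
      rw [div_pow, cpow_nat_inv_pow _ hn, div_self (pow_ne_zero n hz)])
    exact ⟨⟨k, hk⟩, hz, by simp only [hk']; field_simp⟩

variable {E : Type*} [NormedAddCommGroup E] [NormedSpace ℝ E]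

theorem abs_det_deriv_pow (n : ℕ) (z : ℂ) :
    |(((n : ℂ) * z ^ (n - 1)) • (1 : ℂ →L[ℝ] ℂ)).det| = (n : ℝ) ^ 2 * ‖z‖ ^ (2 * (n - 1)) := by
  rw [det_smul_one, abs_of_nonneg (by positivity), norm_mul, norm_pow, norm_natCast, mul_pow,
    ← pow_mul, mul_comm (n - 1)]

theorem hasFDerivWithinAt_pow_real (n : ℕ) (s : Set ℂ) (z : ℂ) :
    HasFDerivWithinAt (fun z : ℂ => z ^ n) (((n : ℂ) * z ^ (n - 1)) • (1 : ℂ →L[ℝ] ℂ)) s z :=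
  (hasDerivAt_pow n z).complexToReal_fderiv.hasFDerivWithinAt

theorem compl_zero_ae_eq_univ : ({0}ᶜ : Set ℂ) =ᵐ[volume] Set.univ :=
  ae_eq_univ.2 (by simp)

theorem integrableOn_powBranch {f : ℂ → E} (hf : Integrable f) :
    IntegrableOn (fun z => ((n : ℝ) ^ 2 * ‖z‖ ^ (2 * (n - 1))) • f (z ^ n)) (powBranch n ζ) := by
  have h := (integrableOn_image_iff_integrableOn_abs_det_fderiv_smul volume
    measurableSet_powBranch (fun z _ => hasFDerivWithinAt_pow_real n (powBranch n ζ) z)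
    injOn_pow_powBranch f).1 hf.integrableOn
  simpa only [abs_det_deriv_pow] using h

theorem setIntegral_powBranch (hn : n ≠ 0) (hζ : ζ ^ n = 1) (f : ℂ → E) :
    ∫ z in powBranch n ζ, ((n : ℝ) ^ 2 * ‖z‖ ^ (2 * (n - 1))) • f (z ^ n) = ∫ w, f w := by
  have h := integral_image_eq_integral_abs_det_fderiv_smul volume
    measurableSet_powBranch (fun z _ => hasFDerivWithinAt_pow_real n (powBranch n ζ) z)
    injOn_pow_powBranch f
  rw [image_pow_powBranch hn hζ, setIntegral_congr_set compl_zero_ae_eq_univ, setIntegral_univ] at h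
  simpa only [abs_det_deriv_pow] using h.symm

theorem integrable_comp_pow (hn : n ≠ 0) {f : ℂ → E} (hf : Integrable f) :
    Integrable fun z : ℂ => ((n : ℝ) ^ 2 * ‖z‖ ^ (2 * (n - 1))) • f (z ^ n) := by
  have hζ := isPrimitiveRoot_exp n hn
  rw [← integrableOn_univ, ← integrableOn_congr_set_ae compl_zero_ae_eq_univ,
    ← iUnion_powBranch hn hζ, integrableOn_finite_iUnion]
  exact fun _ => integrableOn_powBranch hf

/-- Change of variables `w = z ^ n` on the complex plane. -/
theorem integral_comp_pow (hn : n ≠ 0) {f : ℂ → E} (hf : Integrable f) :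
    ∫ z : ℂ, ((n : ℝ) ^ 2 * ‖z‖ ^ (2 * (n - 1))) • f (z ^ n) = n • ∫ w, f w := by
  have hζ := isPrimitiveRoot_exp n hn
  have hpow (k : ℕ) : (Complex.exp (2 * π * I / n) ^ k) ^ n = 1 := by
    rw [pow_right_comm, hζ.pow_eq_one, one_pow]
  rw [← setIntegral_univ, ← setIntegral_congr_set compl_zero_ae_eq_univ, ← iUnion_powBranch hn hζ,
    integral_iUnion_fintype (fun _ => measurableSet_powBranch)
      (fun i j hij => disjoint_powBranch fun h => hij (Fin.ext (hζ.pow_inj i.2 j.2 h)))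
      (fun _ => integrableOn_powBranch hf)]
  simp_rw [setIntegral_powBranch hn (hpow _)]
  simp

end Complex

theorem integrable_div_one_add_mul_norm_sq_pow_three {a : ℝ} (ha : 0 < a) :
    Integrable fun u : ℂ => u / (((1 + a * ‖u‖ ^ 2) ^ 3 : ℝ) : ℂ) := by
  have h := (integrable_rpow_neg_one_add_norm_sq (E := ℂ) (μ := volume) (r := 4)
    (by rw [Complex.finrank_real_complex]; norm_num)).const_mul ((min 1 a ^ 3)⁻¹)
  refine h.mono' (Measurable.aestronglyMeasurable (by fun_prop)) (.of_forall fun u => ?_)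
  have hm : 0 < min 1 a := lt_min one_pos ha
  have hlow : min 1 a * (1 + ‖u‖ ^ 2) ≤ 1 + a * ‖u‖ ^ 2 := by
    nlinarith [min_le_left 1 a, mul_le_mul_of_nonneg_right (min_le_right 1 a) (sq_nonneg ‖u‖)]
  have hpow : (1 + ‖u‖ ^ 2) ^ (-4 / 2 : ℝ) = ((1 + ‖u‖ ^ 2) ^ 2)⁻¹ := by
    rw [← Real.rpow_natCast (1 + ‖u‖ ^ 2) 2, ← Real.rpow_neg (by positivity)]
    norm_num
  rw [hpow, norm_div, Complex.norm_real, Real.norm_of_nonneg (by positivity)]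
  calc ‖u‖ / (1 + a * ‖u‖ ^ 2) ^ 3
      ≤ (1 + ‖u‖ ^ 2) / (min 1 a * (1 + ‖u‖ ^ 2)) ^ 3 := by
        gcongr
        nlinarith [sq_nonneg (‖u‖ - 1), norm_nonneg u]
    _ = (min 1 a ^ 3)⁻¹ * ((1 + ‖u‖ ^ 2) ^ 2)⁻¹ := by
        field_simp

/-- the ℂ-valued vanishing integral identity
`∫_ℂ (z^{N+1} − P)|z|^{2N} / (1 + a|z^{N+1} − P|²)³ dz = 0`. -/
theorem vanishing_integral_translation_kernel (N : ℕ) (a : ℝ) (ha : 0 < a) (P : ℂ) :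
    Integrable (fun z : ℂ =>
      (z ^ (N + 1) - P) * ((‖z‖ ^ (2 * N) : ℝ) : ℂ) /
        (((1 + a * ‖z ^ (N + 1) - P‖ ^ 2) ^ 3 : ℝ) : ℂ)) volume ∧
    (∫ z : ℂ,
      (z ^ (N + 1) - P) * ((‖z‖ ^ (2 * N) : ℝ) : ℂ) /
        (((1 + a * ‖z ^ (N + 1) - P‖ ^ 2) ^ 3 : ℝ) : ℂ)) = 0 := by
  set h : ℂ → ℂ := fun u => u / (((1 + a * ‖u‖ ^ 2) ^ 3 : ℝ) : ℂ) with h_def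
  have h_int : Integrable fun w => h (w - P) :=
    (integrable_div_one_add_mul_norm_sq_pow_three ha).comp_sub_right P
  have h_zero : ∫ w, h (w - P) = 0 := by
    rw [integral_sub_right_eq_self h P, ← self_eq_neg, ← integral_neg, ← integral_neg_eq_self h]
    simp [h_def, neg_div]
  have h_eq : (fun z : ℂ => (z ^ (N + 1) - P) * ((‖z‖ ^ (2 * N) : ℝ) : ℂ) /
        (((1 + a * ‖z ^ (N + 1) - P‖ ^ 2) ^ 3 : ℝ) : ℂ)) =
      fun z => ((((N + 1 : ℕ) : ℝ) ^ 2)⁻¹) •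
        ((((N + 1 : ℕ) : ℝ) ^ 2 * ‖z‖ ^ (2 * (N + 1 - 1))) • h (z ^ (N + 1) - P)) := by
    funext z
    have hN : (((N + 1 : ℕ) : ℝ) ^ 2) ≠ 0 := by positivity
    rw [smul_smul, inv_mul_cancel_left₀ hN, Complex.real_smul, Nat.add_sub_cancel]
    ring
  rw [h_eq]
  refine ⟨Integrable.fun_smul _ (Complex.integrable_comp_pow N.succ_ne_zero h_int), ?_⟩
  rw [integral_smul, Complex.integral_comp_pow N.succ_ne_zero h_int, h_zero, smul_zero, smul_zero]
end

section
/- Let c₁ > 0 and let g₀₁(r) = (1 − c₁r²)/(1 + c₁r²), which solves the radial linearized Liouville ODE g'' + (1/r)g' + (8c₁/(1 + c₁r²)²)·g = 0 on (0,∞). Then there exist R₀ ≥ 1, C > 0 and a twice continuously differentiable function g₀₂ on (R₀,∞) solving the same ODE g₀₂'' + (1/r)g₀₂' + (8c₁/(1 + c₁r²)²)·g₀₂ = 0 on (R₀,∞), such that g₀₂ is not a scalar multiple of g₀₁ on (R₀,∞) and |g₀₂(r)| ≤ C·log r for all r > R₀. -/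
open Real

section

variable {c : ℝ}

/-- The bounded radial solution of the linearized Liouville equation. -/
noncomputable def liouvilleKernel (c r : ℝ) : ℝ := (1 - c * r ^ 2) / (1 + c * r ^ 2)

/-- The derivative of `liouvilleKernel`. -/
noncomputable def liouvilleKernelDeriv (c r : ℝ) : ℝ := -(4 * c * r) / (1 + c * r ^ 2) ^ 2

/-- The second derivative of `liouvilleKernel`. -/
noncomputable def liouvilleKernelDeriv₂ (c r : ℝ) : ℝ :=
  (12 * c ^ 2 * r ^ 2 - 4 * c) / (1 + c * r ^ 2) ^ 3

lemma hasDerivAt_one_add_mul_sq (c r : ℝ) :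
    HasDerivAt (fun x : ℝ => 1 + c * x ^ 2) (2 * c * r) r := by
  refine (((hasDerivAt_pow 2 r).const_mul c).const_add 1).congr_deriv ?_
  norm_num
  ring

lemma hasDerivAt_liouvilleKernel (hc : 0 < c) (r : ℝ) :
    HasDerivAt (liouvilleKernel c) (liouvilleKernelDeriv c r) r := by
  have h0 : 1 + c * r ^ 2 ≠ 0 := by positivity
  have hn : HasDerivAt (fun x : ℝ => 1 - c * x ^ 2) (-(2 * c * r)) r := by
    refine (((hasDerivAt_pow 2 r).const_mul c).const_sub 1).congr_deriv ?_
    norm_num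
    ring
  refine (hn.div (hasDerivAt_one_add_mul_sq c r) h0).congr_deriv ?_
  unfold liouvilleKernelDeriv
  field_simp
  ring

lemma hasDerivAt_liouvilleKernelDeriv (hc : 0 < c) (r : ℝ) :
    HasDerivAt (liouvilleKernelDeriv c) (liouvilleKernelDeriv₂ c r) r := by
  have h0 : 1 + c * r ^ 2 ≠ 0 := by positivity
  have hn : HasDerivAt (fun x : ℝ => -(4 * c * x)) (-(4 * c)) r := by
    exact ((hasDerivAt_id r).const_mul (4 * c)).neg.congr_deriv (by ring)
  refine (hn.div ((hasDerivAt_one_add_mul_sq c r).pow 2) (pow_ne_zero 2 h0)).congr_deriv ?_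
  unfold liouvilleKernelDeriv₂
  norm_num
  field_simp
  ring

lemma liouvilleKernel_ode (hc : 0 < c) {r : ℝ} (hr : r ≠ 0) :
    liouvilleKernelDeriv₂ c r + 1 / r * liouvilleKernelDeriv c r +
      8 * c / (1 + c * r ^ 2) ^ 2 * liouvilleKernel c r = 0 := by
  have h0 : 1 + c * r ^ 2 ≠ 0 := by positivity
  unfold liouvilleKernel liouvilleKernelDeriv liouvilleKernelDeriv₂
  field_simp
  ring

lemma abs_liouvilleKernel_le_one (hc : 0 < c) (r : ℝ) : |liouvilleKernel c r| ≤ 1 := by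
  have h0 : 0 < 1 + c * r ^ 2 := by positivity
  have h1 : 0 ≤ c * r ^ 2 := by positivity
  rw [liouvilleKernel, abs_div, abs_of_pos h0, div_le_one h0, abs_le]
  constructor <;> linarith

lemma liouvilleKernel_le_neg_half {r : ℝ} (hr : 3 ≤ c * r ^ 2) :
    liouvilleKernel c r ≤ -(1 / 2) := by
  rw [liouvilleKernel, div_le_iff₀ (by linarith)]
  linarith

/-- The logarithmically growing radial solution of the linearized Liouville equation. -/
noncomputable def liouvilleLogKernel (c r : ℝ) : ℝ := liouvilleKernel c r * log r + 1

lemma hasDerivAt_liouvilleLogKernel (hc : 0 < c) {r : ℝ} (hr : r ≠ 0) :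
    HasDerivAt (liouvilleLogKernel c)
      (liouvilleKernelDeriv c r * log r + liouvilleKernel c r * r⁻¹) r :=
  ((hasDerivAt_liouvilleKernel hc r).mul (hasDerivAt_log hr)).add_const 1

lemma deriv_deriv_liouvilleLogKernel (hc : 0 < c) {r : ℝ} (hr : r ≠ 0) :
    deriv (deriv (liouvilleLogKernel c)) r =
      liouvilleKernelDeriv₂ c r * log r + 2 * liouvilleKernelDeriv c r / r
        - liouvilleKernel c r / r ^ 2 := by
  have hev : deriv (liouvilleLogKernel c) =ᶠ[nhds r]
      fun x => liouvilleKernelDeriv c x * log x + liouvilleKernel c x * x⁻¹ := by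
    filter_upwards [isOpen_ne.mem_nhds hr] with x hx
    exact (hasDerivAt_liouvilleLogKernel hc hx).deriv
  rw [hev.deriv_eq]
  have h := ((hasDerivAt_liouvilleKernelDeriv hc r).mul (hasDerivAt_log hr)).add
    ((hasDerivAt_liouvilleKernel hc r).mul (hasDerivAt_inv hr))
  refine h.deriv.trans ?_
  field_simp
  ring

lemma liouvilleLogKernel_ode (hc : 0 < c) {r : ℝ} (hr : r ≠ 0) :
    deriv (deriv (liouvilleLogKernel c)) r + 1 / r * deriv (liouvilleLogKernel c) r +
      8 * c / (1 + c * r ^ 2) ^ 2 * liouvilleLogKernel c r = 0 := by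
  rw [deriv_deriv_liouvilleLogKernel hc hr, (hasDerivAt_liouvilleLogKernel hc hr).deriv]
  have hcancel : 2 * liouvilleKernelDeriv c r / r + 8 * c / (1 + c * r ^ 2) ^ 2 = 0 := by
    have h0 : 1 + c * r ^ 2 ≠ 0 := by positivity
    unfold liouvilleKernelDeriv
    field_simp
    ring
  unfold liouvilleLogKernel
  linear_combination log r * liouvilleKernel_ode hc hr + hcancel

lemma contDiffOn_liouvilleLogKernel (hc : 0 < c) :
    ContDiffOn ℝ 2 (liouvilleLogKernel c) {0}ᶜ := by
  unfold liouvilleLogKernel liouvilleKernel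
  refine ((ContDiffOn.div (by fun_prop) (by fun_prop) fun x _ => ?_).mul
    contDiffOn_log).add contDiffOn_const
  positivity

lemma abs_liouvilleLogKernel_le (hc : 0 < c) {r : ℝ} (hr : 3 < r) :
    |liouvilleLogKernel c r| ≤ 2 * log r := by
  have hlog : 1 ≤ log r := by
    rw [le_log_iff_exp_le (by linarith)]
    linarith [exp_one_lt_three]
  calc |liouvilleLogKernel c r| ≤ |liouvilleKernel c r * log r| + |1| := abs_add_le _ _
    _ = |liouvilleKernel c r| * log r + 1 := by
        rw [abs_mul, abs_of_nonneg (zero_le_one.trans hlog), abs_one]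
    _ ≤ 1 * log r + log r := by
        gcongr
        exact abs_liouvilleKernel_le_one hc r
    _ = 2 * log r := by ring

lemma exists_liouvilleLogKernel_ne (hc : 0 < c) (R k : ℝ) :
    ∃ r, R < r ∧ liouvilleLogKernel c r ≠ k * liouvilleKernel c r := by
  refine ⟨1 + |R| + exp (k + 3) + 3 / c, ?_, fun h => ?_⟩
  · have : 0 < 3 / c := by positivity
    linarith [le_abs_self R, exp_pos (k + 3)]
  set r := 1 + |R| + exp (k + 3) + 3 / c with hr
  have hpos : 0 < 3 / c := by positivity
  have hexp : exp (k + 3) ≤ r := by linarith [abs_nonneg R]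
  have hone : 1 ≤ r := by linarith [abs_nonneg R, exp_pos (k + 3)]
  have hlog : k + 3 ≤ log r := (le_log_iff_exp_le (by linarith)).2 hexp
  have hcr : 3 ≤ c * r := by
    have : 3 / c ≤ r := by linarith [abs_nonneg R, exp_pos (k + 3)]
    rwa [div_le_iff₀' hc] at this
  have hg : liouvilleKernel c r ≤ -(1 / 2) := liouvilleKernel_le_neg_half (by nlinarith)
  unfold liouvilleLogKernel at h
  nlinarith

end

/-- the first fundamental solution `g₀₁(r) = (1 − c₁r²)/(1 + c₁r²)` of the radial
linearized Liouville ODE, and existence of a second, logarithmically growing fundamental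
solution `g₀₂` (obtained by reduction of order). -/
theorem second_fundamental_solution (c₁ : ℝ) (hc : 0 < c₁) (g01 : ℝ → ℝ)
    (hg01 : ∀ r : ℝ, g01 r = (1 - c₁ * r ^ 2) / (1 + c₁ * r ^ 2)) :
    (∀ r : ℝ, 0 < r →
      deriv (deriv g01) r + 1 / r * deriv g01 r + 8 * c₁ / (1 + c₁ * r ^ 2) ^ 2 * g01 r = 0) ∧
    ∃ R₀ : ℝ, 1 ≤ R₀ ∧ ∃ C > (0 : ℝ), ∃ g02 : ℝ → ℝ,
      ContDiffOn ℝ 2 g02 (Set.Ioi R₀) ∧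
      (∀ r : ℝ, R₀ < r →
        deriv (deriv g02) r + 1 / r * deriv g02 r +
          8 * c₁ / (1 + c₁ * r ^ 2) ^ 2 * g02 r = 0) ∧
      (¬ ∃ k : ℝ, ∀ r : ℝ, R₀ < r → g02 r = k * g01 r) ∧
      (∀ r : ℝ, R₀ < r → |g02 r| ≤ C * Real.log r) := by
  obtain rfl : g01 = liouvilleKernel c₁ := funext hg01
  refine ⟨fun r hr => ?_, 3, by norm_num, 2, two_pos, liouvilleLogKernel c₁, ?_, ?_, ?_, ?_⟩
  · rw [show deriv (liouvilleKernel c₁) = liouvilleKernelDeriv c₁ from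
      funext fun x => (hasDerivAt_liouvilleKernel hc x).deriv,
      (hasDerivAt_liouvilleKernelDeriv hc r).deriv]
    exact liouvilleKernel_ode hc hr.ne'
  · exact (contDiffOn_liouvilleLogKernel hc).mono fun r (hr : 3 < r) => by
      simp only [Set.mem_compl_iff, Set.mem_singleton_iff]
      linarith
  · exact fun r hr => liouvilleLogKernel_ode hc (by linarith)
  · rintro ⟨k, hk⟩
    obtain ⟨r, hr, hne⟩ := exists_liouvilleLogKernel_ne hc 3 k
    exact hne (hk r hr)
  · exact fun r hr => abs_liouvilleLogKernel_le hc hr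
end

section
/- Let R > 0 and let v be twice continuously differentiable on the open disk B(0,R) ⊂ ℝ². Define the spherical average v̄(r) = (1/2π)·∫₀^{2π} v(r·cos θ, r·sin θ) dθ for 0 ≤ r < R. Then v̄ is differentiable on (0,R) and for every 0 < r < R, v̄'(r) = (1/(2πr))·∫_{B(0,r)} Δv(x) dx, where Δv is the Euclidean Laplacian of v and the integral is with respect to two-dimensional Lebesgue measure. -/
open Real MeasureTheory

/-- The Euclidean Laplacian on ℝ² = EuclideanSpace ℝ (Fin 2):
sum of the two pure second partial derivatives. -/
noncomputable def lap2 (f : EuclideanSpace ℝ (Fin 2) → ℝ) (x : EuclideanSpace ℝ (Fin 2)) : ℝ :=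
  ∑ i : Fin 2,
    fderiv ℝ (fun y => fderiv ℝ f y (EuclideanSpace.single i 1)) x (EuclideanSpace.single i 1)

open Set Topology

/-- The point of the Euclidean plane with polar coordinates `p = (ρ, θ)`. -/
noncomputable def polarPoint (p : ℝ × ℝ) : EuclideanSpace ℝ (Fin 2) :=
  p.1 • (cos p.2 • EuclideanSpace.single 0 1 + sin p.2 • EuclideanSpace.single 1 1)

lemma polarPoint_eq (p : ℝ × ℝ) :
    polarPoint p = (WithLp.equiv 2 (Fin 2 → ℝ)).symm ![p.1 * cos p.2, p.1 * sin p.2] := by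
  ext i
  fin_cases i <;> simp [polarPoint]

lemma norm_polarPoint (p : ℝ × ℝ) : ‖polarPoint p‖ = |p.1| := by
  rw [EuclideanSpace.norm_eq, ← sqrt_sq_eq_abs]
  congr 1
  simp [polarPoint, Fin.sum_univ_two]
  linear_combination p.1 ^ 2 * sin_sq_add_cos_sq p.2

lemma contDiff_polarPoint {n : WithTop ℕ∞} : ContDiff ℝ n polarPoint := by
  unfold polarPoint
  fun_prop

lemma hasFDerivAt_polarPoint (p : ℝ × ℝ) :
    HasFDerivAt polarPoint
      ((ContinuousLinearMap.fst ℝ ℝ ℝ).smulRight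
          (cos p.2 • EuclideanSpace.single 0 1 + sin p.2 • EuclideanSpace.single 1 1) +
        (ContinuousLinearMap.snd ℝ ℝ ℝ).smulRight
          (p.1 • (-sin p.2 • EuclideanSpace.single 0 1 + cos p.2 • EuclideanSpace.single 1 1)))
      p := by
  have hfst : HasFDerivAt (fun q : ℝ × ℝ => q.1) (ContinuousLinearMap.fst ℝ ℝ ℝ) p :=
    hasFDerivAt_fst
  have hsnd : HasFDerivAt (fun q : ℝ × ℝ => q.2) (ContinuousLinearMap.snd ℝ ℝ ℝ) p :=
    hasFDerivAt_snd
  have h : HasFDerivAt polarPoint _ p := hfst.smul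
    ((hsnd.cos.smul_const (EuclideanSpace.single 0 1 : EuclideanSpace ℝ (Fin 2))).add
      (hsnd.sin.smul_const (EuclideanSpace.single 1 1)))
  refine h.congr_fderiv ?_
  ext i <;> simp

lemma setIntegral_ball_eq_polarPoint {f : EuclideanSpace ℝ (Fin 2) → ℝ} {r : ℝ} (hr : 0 < r)
    (hf : ContinuousOn f (Metric.closedBall 0 r)) :
    ∫ x in Metric.ball (0 : EuclideanSpace ℝ (Fin 2)) r, f x =
      ∫ ρ in (0 : ℝ)..r, ∫ θ in -π..π, ρ * f (polarPoint (ρ, θ)) := by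
  have hsymm (p : ℝ × ℝ) :
      Complex.orthonormalBasisOneI.repr (Complex.polarCoord.symm p) = polarPoint p := by
    rw [polarPoint_eq]
    ext i
    rw [Complex.orthonormalBasisOneI_repr_apply]
    fin_cases i <;> simp [-Complex.ofReal_cos, -Complex.ofReal_sin]
  have hint : IntegrableOn (fun p : ℝ × ℝ => p.1 * f (polarPoint p))
      (Ioc 0 r ×ˢ Ioc (-π) π) (volume.prod volume) := by
    have : IntegrableOn (fun p : ℝ × ℝ => p.1 * f (polarPoint p))
        (Icc 0 r ×ˢ Icc (-π) π) (volume.prod volume) := by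
      refine ContinuousOn.integrableOn_compact (isCompact_Icc.prod isCompact_Icc) ?_
      refine continuousOn_fst.mul (hf.comp (contDiff_polarPoint (n := 0)).continuous.continuousOn ?_)
      rintro p ⟨hp, -⟩
      simpa [norm_polarPoint, abs_of_nonneg hp.1] using hp.2
    exact this.mono_set (Set.prod_mono Ioc_subset_Icc_self Ioc_subset_Icc_self)
  rw [intervalIntegral.integral_of_le hr.le]
  simp_rw [intervalIntegral.integral_of_le (neg_le_self pi_pos.le)]
  rw [← setIntegral_prod _ hint, ← integral_indicator Metric.isOpen_ball.measurableSet,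
    ← Complex.orthonormalBasisOneI.measurePreserving_repr.integral_comp
      Complex.orthonormalBasisOneI.repr.toHomeomorph.measurableEmbedding,
    ← Complex.integral_comp_polarCoord_symm]
  simp_rw [hsymm]
  have hind : EqOn
      (fun p : ℝ × ℝ => p.1 • (Metric.ball (0 : EuclideanSpace ℝ (Fin 2)) r).indicator f
        (polarPoint p))
      ((Iio r ×ˢ univ).indicator fun p : ℝ × ℝ => p.1 * f (polarPoint p)) polarCoord.target := by
    rintro p ⟨hp, -⟩
    have hp' : 0 < p.1 := hp
    by_cases h : p.1 < r <;> simp [indicator, norm_polarPoint, abs_of_pos hp', h]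
  rw [setIntegral_congr_fun polarCoord.open_target.measurableSet hind,
    setIntegral_indicator (measurableSet_Iio.prod MeasurableSet.univ), polarCoord_target,
    prod_inter_prod, inter_univ, Ioi_inter_Iio]
  exact setIntegral_congr_set (Measure.set_prod_ae_eq Ioo_ae_eq_Ioc Ioo_ae_eq_Ioc)

/-- The divergence theorem on a disk centered at the origin of the plane. -/
lemma setIntegral_ball_divergence {R r : ℝ} (hr : 0 < r) (hrR : r < R)
    {a b : EuclideanSpace ℝ (Fin 2) → ℝ} (ha : ContDiffOn ℝ 1 a (Metric.ball 0 R))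
    (hb : ContDiffOn ℝ 1 b (Metric.ball 0 R)) :
    ∫ x in Metric.ball (0 : EuclideanSpace ℝ (Fin 2)) r,
        (fderiv ℝ a x (EuclideanSpace.single 0 1) + fderiv ℝ b x (EuclideanSpace.single 1 1)) =
      r * ∫ θ in -π..π, (cos θ * a (polarPoint (r, θ)) + sin θ * b (polarPoint (r, θ))) := by
  have hda := ha.continuousOn_fderiv_of_isOpen Metric.isOpen_ball le_rfl
  have hdb := hb.continuousOn_fderiv_of_isOpen Metric.isOpen_ball le_rfl
  have hcont : ContinuousOn (fun x => fderiv ℝ a x (EuclideanSpace.single 0 1) +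
      fderiv ℝ b x (EuclideanSpace.single 1 1)) (Metric.ball 0 R) :=
    (hda.clm_apply continuousOn_const).add (hdb.clm_apply continuousOn_const)
  rw [setIntegral_ball_eq_polarPoint hr (hcont.mono (Metric.closedBall_subset_ball hrR))]
  have hP : ContDiff ℝ 1 polarPoint := contDiff_polarPoint
  set S : Set (ℝ × ℝ) := polarPoint ⁻¹' Metric.ball 0 R with hS
  have hSo : IsOpen S := Metric.isOpen_ball.preimage hP.continuous
  have hsub : uIcc 0 r ×ˢ uIcc (-π) π ⊆ S := by
    rintro p ⟨hp, -⟩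
    rw [uIcc_of_le hr.le] at hp
    simpa [hS, norm_polarPoint, abs_of_nonneg hp.1] using hp.2.trans_lt hrR
  have haP : ContDiffOn ℝ 1 (a ∘ polarPoint) S := ha.comp hP.contDiffOn fun _ h => h
  have hbP : ContDiffOn ℝ 1 (b ∘ polarPoint) S := hb.comp hP.contDiffOn fun _ h => h
  let f (p : ℝ × ℝ) : ℝ :=
    p.1 * (cos p.2 * (a ∘ polarPoint) p + sin p.2 * (b ∘ polarPoint) p)
  let g (p : ℝ × ℝ) : ℝ := -sin p.2 * (a ∘ polarPoint) p + cos p.2 * (b ∘ polarPoint) p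
  have hcos : ContDiffOn ℝ 1 (fun p : ℝ × ℝ => cos p.2) S :=
    (contDiff_cos.comp contDiff_snd).contDiffOn
  have hsin : ContDiffOn ℝ 1 (fun p : ℝ × ℝ => sin p.2) S :=
    (contDiff_sin.comp contDiff_snd).contDiffOn
  have hf : ContDiffOn ℝ 1 f S := contDiffOn_fst.mul ((hcos.mul haP).add (hsin.mul hbP))
  have hg : ContDiffOn ℝ 1 g S := (hsin.neg.mul haP).add (hcos.mul hbP)
  have hdiv : EqOn (fun p => fderiv ℝ f p (1, 0) + fderiv ℝ g p (0, 1))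
      (fun p => p.1 * (fderiv ℝ a (polarPoint p) (EuclideanSpace.single 0 1) +
        fderiv ℝ b (polarPoint p) (EuclideanSpace.single 1 1))) S := by
    intro p hp
    have hPp := hasFDerivAt_polarPoint p
    have hap : HasFDerivAt (a ∘ polarPoint) _ p :=
      ((ha.differentiableOn one_ne_zero).differentiableAt
        (Metric.isOpen_ball.mem_nhds hp)).hasFDerivAt.comp p hPp
    have hbp : HasFDerivAt (b ∘ polarPoint) _ p :=
      ((hb.differentiableOn one_ne_zero).differentiableAt
        (Metric.isOpen_ball.mem_nhds hp)).hasFDerivAt.comp p hPp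
    have hfp : HasFDerivAt f _ p :=
      hasFDerivAt_fst.mul ((hasFDerivAt_snd.cos.mul hap).add (hasFDerivAt_snd.sin.mul hbp))
    have hgp : HasFDerivAt g _ p :=
      (hasFDerivAt_snd.sin.neg.mul hap).add (hasFDerivAt_snd.cos.mul hbp)
    dsimp only
    rw [hfp.fderiv, hgp.fderiv]
    simp
    linear_combination (p.1 * (fderiv ℝ a (polarPoint p) (EuclideanSpace.single 0 1) +
        fderiv ℝ b (polarPoint p) (EuclideanSpace.single 1 1))) * sin_sq_add_cos_sq p.2
  have hmem {p : ℝ × ℝ}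
      (hp : p ∈ Ioo (min 0 r) (max 0 r) ×ˢ Ioo (min (-π) π) (max (-π) π)) : p ∈ S :=
    hsub (Set.prod_mono Ioo_subset_Icc_self Ioo_subset_Icc_self hp)
  have key := integral2_divergence_prod_of_hasFDerivAt f g (fderiv ℝ f) (fderiv ℝ g) 0 (-π) r π
    (hf.continuousOn.mono hsub) (hg.continuousOn.mono hsub)
    (fun p hp => ((hf.differentiableOn one_ne_zero).differentiableAt
      (hSo.mem_nhds (hmem hp))).hasFDerivAt)
    (fun p hp => ((hg.differentiableOn one_ne_zero).differentiableAt
      (hSo.mem_nhds (hmem hp))).hasFDerivAt)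
    (ContinuousOn.integrableOn_compact (isCompact_uIcc.prod isCompact_uIcc)
      ((((hf.continuousOn_fderiv_of_isOpen hSo le_rfl).clm_apply continuousOn_const).add
        ((hg.continuousOn_fderiv_of_isOpen hSo le_rfl).clm_apply continuousOn_const)).mono hsub))
  have hgper (ρ : ℝ) : g (ρ, π) = g (ρ, -π) := by simp [g, polarPoint]
  have hf0 (θ : ℝ) : f (0, θ) = 0 := by simp [f]
  simp only [hgper, hf0, sub_self, zero_add, intervalIntegral.integral_zero, sub_zero] at key
  rw [← intervalIntegral.integral_const_mul, ← intervalIntegral.integral_congr fun ρ hρ =>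
    intervalIntegral.integral_congr fun θ hθ => hdiv (hsub (mk_mem_prod hρ hθ))]
  exact key

/-- Differentiation under the integral sign for circle averages. -/
lemma hasDerivAt_integral_polarPoint {R r : ℝ} (hr : 0 < r) (hrR : r < R)
    {v : EuclideanSpace ℝ (Fin 2) → ℝ} (hv : ContDiffOn ℝ 1 v (Metric.ball 0 R)) (α β : ℝ) :
    HasDerivAt (fun ρ => ∫ θ in α..β, v (polarPoint (ρ, θ)))
      (∫ θ in α..β, fderiv ℝ v (polarPoint (r, θ)) (polarPoint (1, θ))) r := by
  obtain ⟨s, hrs, hsR⟩ := exists_between hrR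
  have hdv := hv.continuousOn_fderiv_of_isOpen Metric.isOpen_ball le_rfl
  obtain ⟨C, hC⟩ :=
    (isCompact_closedBall (0 : EuclideanSpace ℝ (Fin 2)) s).exists_bound_of_continuousOn
    (hdv.mono (Metric.closedBall_subset_ball hsR))
  have hP : Continuous polarPoint := (contDiff_polarPoint (n := 0)).continuous
  have hPball {ρ : ℝ} (hρ : ρ ∈ Ioo 0 s) (θ : ℝ) : polarPoint (ρ, θ) ∈ Metric.ball 0 s := by
    simpa [norm_polarPoint, abs_of_pos hρ.1] using hρ.2
  have hPR {ρ : ℝ} (hρ : ρ ∈ Ioo 0 s) (θ : ℝ) : polarPoint (ρ, θ) ∈ Metric.ball 0 R :=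
    Metric.ball_subset_ball hsR.le (hPball hρ θ)
  have hvP {ρ : ℝ} (hρ : ρ ∈ Ioo 0 s) : Continuous fun θ => v (polarPoint (ρ, θ)) :=
    hv.continuousOn.comp_continuous (by fun_prop) (hPR hρ)
  have hnhds : Ioo 0 s ∈ 𝓝 r := Ioo_mem_nhds hr hrs
  refine (intervalIntegral.hasDerivAt_integral_of_dominated_loc_of_deriv_le
    (F := fun ρ θ => v (polarPoint (ρ, θ)))
    (F' := fun ρ θ => fderiv ℝ v (polarPoint (ρ, θ)) (polarPoint (1, θ)))
    (bound := fun _ => C) hnhds ?_ ((hvP ⟨hr, hrs⟩).intervalIntegrable _ _) ?_ ?_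
    intervalIntegrable_const ?_).2
  · filter_upwards [hnhds] with ρ hρ using (hvP hρ).aestronglyMeasurable
  · exact ((hdv.comp_continuous (by fun_prop) (hPR ⟨hr, hrs⟩)).clm_apply
      (by fun_prop)).aestronglyMeasurable
  · refine Filter.Eventually.of_forall fun θ _ ρ hρ => ?_
    refine ((fderiv ℝ v _).le_opNorm _).trans ?_
    simpa [norm_polarPoint] using hC _ (Metric.ball_subset_closedBall (hPball hρ θ))
  · refine Filter.Eventually.of_forall fun θ _ ρ hρ => ?_
    have hd : HasDerivAt (fun ρ => polarPoint (ρ, θ)) (polarPoint (1, θ)) ρ := by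
      simpa [polarPoint] using (hasDerivAt_id ρ).smul_const (polarPoint (1, θ))
    exact ((hv.differentiableOn one_ne_zero).differentiableAt
      (Metric.isOpen_ball.mem_nhds (hPR hρ θ))).hasFDerivAt.comp_hasDerivAt ρ hd

/-- derivative of the spherical average:
`v̄'(r) = (1/(2πr)) ∫_{B(0,r)} Δv` for `0 < r < R`. -/
theorem spherical_average_derivative (R : ℝ) (hR : 0 < R)
    (v : EuclideanSpace ℝ (Fin 2) → ℝ)
    (hv : ContDiffOn ℝ 2 v (Metric.ball 0 R)) (vbar : ℝ → ℝ)
    (hvbar : ∀ r : ℝ, vbar r =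
      1 / (2 * π) * ∫ θ in (0 : ℝ)..2 * π,
        v ((WithLp.equiv 2 (Fin 2 → ℝ)).symm ![r * Real.cos θ, r * Real.sin θ])) :
    ∀ r : ℝ, 0 < r → r < R →
      HasDerivAt vbar
        (1 / (2 * π * r) *
          ∫ x in Metric.ball (0 : EuclideanSpace ℝ (Fin 2)) r, lap2 v x) r := by
  intro r hr hrR
  have hvbar' : vbar = fun r => 1 / (2 * π) * ∫ θ in (0 : ℝ)..2 * π, v (polarPoint (r, θ)) := by
    ext r
    simp_rw [hvbar, polarPoint_eq]
  have hpart (i : Fin 2) :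
      ContDiffOn ℝ 1 (fun y => fderiv ℝ v y (EuclideanSpace.single i 1)) (Metric.ball 0 R) :=
    (hv.fderiv_of_isOpen Metric.isOpen_ball (by norm_num)).clm_apply contDiffOn_const
  have hdiv := setIntegral_ball_divergence hr hrR (hpart 0) (hpart 1)
  have hper : Function.Periodic
      (fun θ => fderiv ℝ v (polarPoint (r, θ)) (polarPoint (1, θ))) (2 * π) := by
    intro θ
    simp [polarPoint]
  have hshift := hper.intervalIntegral_add_eq 0 (-π)
  rw [zero_add, show -π + 2 * π = π by ring] at hshift
  have h := (hasDerivAt_integral_polarPoint hr hrR (hv.of_le one_le_two) 0 (2 * π)).const_mul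
    (1 / (2 * π))
  rw [hvbar']
  refine h.congr_deriv ?_
  simp only [lap2, Fin.sum_univ_two]
  rw [hdiv, hshift, ← mul_assoc, show 1 / (2 * π * r) * r = 1 / (2 * π) by field_simp]
  simp [polarPoint]
end

section
/- There is an absolute constant C > 0 with the following property: for every μ ∈ ℝ, λ > 0, and L ≥ 2, the function V(y) = log( e^μ / (1 + (e^μ/λ)|y² − e₁|²)² ) on ℂ ≅ ℝ² (where y² is the complex square and e₁ = 1 ∈ ℂ) satisfies the oscillation bound sup_{|y| = L} V(y) − inf_{|y| = L} V(y) ≤ C/L². -/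
open Real

/-- The squared distances from `1` to two points of a circle of radius `L ^ 2 ≥ 4` differ by at
most a multiple `8 / L ^ 2` of either of them. -/
lemma sq_norm_sub_one_diff_le {L : ℝ} (hL : 2 ≤ L) {z w : ℂ} (hz : ‖z‖ = L ^ 2)
    (hw : ‖w‖ = L ^ 2) :
    (‖w - 1‖ ^ 2 - ‖z - 1‖ ^ 2) * L ^ 2 ≤ 8 * ‖z - 1‖ ^ 2 := by
  have h_lower : L ^ 2 - 1 ≤ ‖z - 1‖ := by
    simpa [hz] using norm_sub_norm_le z 1
  have h_upper : ‖w - 1‖ ≤ L ^ 2 + 1 := by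
    simpa [hw] using norm_sub_le w 1
  have hL4 : 4 ≤ L ^ 2 := by nlinarith
  have hz_sq : (L ^ 2 - 1) ^ 2 ≤ ‖z - 1‖ ^ 2 := by gcongr; linarith
  have hw_sq : ‖w - 1‖ ^ 2 ≤ (L ^ 2 + 1) ^ 2 := by gcongr
  have h_diff : ‖w - 1‖ ^ 2 - ‖z - 1‖ ^ 2 ≤ 4 * L ^ 2 := by linarith
  nlinarith [mul_le_mul_of_nonneg_right h_diff (sq_nonneg L)]

/-- uniform oscillation bound on large circles for
`V(y) = log(e^μ / (1 + (e^μ/λ)|y² − e₁|²)²)`: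
`sup_{|y|=L} V − inf_{|y|=L} V ≤ C/L²`, expressed equivalently as
`V(y₁) − V(y₂) ≤ C/L²` for all `y₁, y₂` on the circle `|y| = L`. -/
theorem oscillation_bound_on_large_circles :
    ∃ C > (0 : ℝ), ∀ μ lam L : ℝ, 0 < lam → 2 ≤ L →
      ∀ V : ℂ → ℝ,
        (∀ y : ℂ, V y = Real.log (Real.exp μ / (1 + Real.exp μ / lam * ‖y ^ 2 - 1‖ ^ 2) ^ 2)) →
        ∀ y₁ y₂ : ℂ, ‖y₁‖ = L → ‖y₂‖ = L → V y₁ - V y₂ ≤ C / L ^ 2 := by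
  refine ⟨16, by norm_num, fun μ lam L hlam hL V hV y₁ y₂ h₁ h₂ => ?_⟩
  have hk : 0 < Real.exp μ / lam := by positivity
  have h_diff := sq_norm_sub_one_diff_le hL (z := y₁ ^ 2) (w := y₂ ^ 2)
    (by rw [norm_pow, h₁]) (by rw [norm_pow, h₂])
  rw [hV, hV]
  set k := Real.exp μ / lam
  set a := ‖y₁ ^ 2 - 1‖ ^ 2
  set b := ‖y₂ ^ 2 - 1‖ ^ 2
  have ha : 0 < 1 + k * a := by positivity
  have hb : 0 < 1 + k * b := by positivity
  have hL0 : 0 < L ^ 2 := by positivity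
  have h_ratio : (1 + k * b) / (1 + k * a) - 1 ≤ 8 / L ^ 2 := by
    rw [div_sub_one ha.ne', div_le_div_iff₀ ha hL0]
    nlinarith [mul_le_mul_of_nonneg_left h_diff hk.le]
  have h_log := (Real.log_le_sub_one_of_pos (div_pos hb ha)).trans h_ratio
  rw [Real.log_div hb.ne' ha.ne'] at h_log
  rw [Real.log_div (Real.exp_ne_zero μ) (by positivity),
    Real.log_div (Real.exp_ne_zero μ) (by positivity), Real.log_pow, Real.log_pow]
  have h_const : (16 : ℝ) / L ^ 2 = 2 * (8 / L ^ 2) := by ring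
  rw [h_const]
  push_cast
  linarith
end
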